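/- For every n ≥ 1, the n-fold concatenation of the word (3,3,2), i.e., the word (3,3,2,3,3,2,…,3,3,2) of length 3n, is an atom. -/

import Mathlib

/-- The look-and-say (audioactive) derivation: replace each maximal run of
`k` consecutive equal symbols `a` in the word by the two symbols `k, a`. -/
def lookAndSay (x : List ℕ+) : List ℕ+ :=
  (x.splitBy (· == ·)).flatMap fun r => [r.length.toPNat', r.headD 1]
/-- An atom: a nonempty word that does not split as the concatenation of two
nonempty words. -/
def IsAtomWord (x : List ℕ+) : Prop :=
  x ≠ [] ∧ ¬ ∃ u v : List ℕ+, u ≠ [] ∧ v ≠ [] ∧ x = u ++ v ∧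
    ∀ n : ℕ, lookAndSay^[n] x = lookAndSay^[n] u ++ lookAndSay^[n] v

theorem las_run (k : ℕ) (a : ℕ+) (s : List ℕ+) (h : s.head? ≠ some a) :
    lookAndSay (List.replicate (k+1) a ++ s) = (k+1).toPNat' :: a :: lookAndSay s := by
  unfold lookAndSay
  rw [List.splitBy_append, List.splitBy_of_isChain (l := List.replicate (k+1) a)]
  · simp [List.replicate_succ]
  · simp
  · exact List.isChain_replicate_of_rel _ (by simp)
  · intro x hx y hy
    have hx' : x = a := by
      have := List.mem_of_getLast? hx
      exact List.eq_of_mem_replicate this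
    subst hx'
    simp only [beq_eq_false_iff_ne]
    rintro rfl
    exact h hy

theorem run_decomp (a : ℕ+) (t : List ℕ+) :
    ∃ k s, a :: t = List.replicate (k+1) a ++ s ∧ s.head? ≠ some a := by
  induction t with
  | nil => exact ⟨0, [], by simp, by simp⟩
  | cons b t ih =>
    by_cases hb : b = a
    · subst hb
      obtain ⟨k, s, h, hs⟩ := ih
      exact ⟨k+1, s, by rw [h, List.replicate_succ (n := k+1)]; rfl, hs⟩
    · exact ⟨0, b :: t, by simp, by simpa using hb⟩

theorem las_nil : lookAndSay [] = [] := rfl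

theorem las_same (a : ℕ+) (t : List ℕ+) :
    ∃ k k' R, lookAndSay (a :: t) = k :: a :: R ∧ lookAndSay (a :: a :: t) = k' :: a :: R := by
  obtain ⟨k, s, h, hs⟩ := run_decomp a t
  refine ⟨(k+1).toPNat', (k+1+1).toPNat', lookAndSay s, ?_, ?_⟩
  · rw [h, las_run k a s hs]
  · rw [← las_run (k+1) a s hs, h, List.replicate_succ (n := k+1)]; rfl

theorem las_one (a b : ℕ+) (t : List ℕ+) (h : a ≠ b) :
    lookAndSay (a :: b :: t) = 1 :: a :: lookAndSay (b :: t) :=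
  las_run 0 a (b :: t) (by simpa using h.symm)

theorem las_single (a : ℕ+) : lookAndSay [a] = [1, a] :=
  las_run 0 a [] (by simp)

theorem las_two (a b : ℕ+) (t : List ℕ+) (h : a ≠ b) :
    lookAndSay (a :: a :: b :: t) = 2 :: a :: lookAndSay (b :: t) :=
  las_run 1 a (b :: t) (by simpa using h.symm)

theorem las_three (a b : ℕ+) (t : List ℕ+) (h : a ≠ b) :
    lookAndSay (a :: a :: a :: b :: t) = 3 :: a :: lookAndSay (b :: t) :=
  las_run 2 a (b :: t) (by simpa using h.symm)

theorem las_last (x : List ℕ+) : (lookAndSay x).getLast? = x.getLast? := by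
  induction x with
  | nil => rfl
  | cons a t ih =>
    cases t with
    | nil => simp [las_single]
    | cons b t =>
      rw [List.getLast?_cons_cons, ← ih]
      by_cases h : a = b
      · subst h
        obtain ⟨k, k', R, h1, h2⟩ := las_same a t
        rw [h1, h2]; simp [List.getLast?_cons_cons]
      · rw [las_one a b t h]
        obtain ⟨k, k', R, h1, h2⟩ := las_same b t
        rw [h1]; simp [List.getLast?_cons_cons]

theorem las_iter_last (n : ℕ) (x : List ℕ+) :
    (lookAndSay^[n] x).getLast? = x.getLast? := by
  induction n with
  | zero => rfl
  | succ n ih => rw [Function.iterate_succ_apply', las_last, ih]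

theorem las_merge (c : ℕ+) (u v : List ℕ+) (hu : u.getLast? = some c) (hv : v.head? = some c) :
    (lookAndSay (u ++ v)).length + 2 = (lookAndSay u).length + (lookAndSay v).length := by
  induction u with
  | nil => simp at hu
  | cons a t ih =>
    cases t with
    | nil =>
      obtain rfl : a = c := by simpa using hu
      cases v with
      | nil => simp at hv
      | cons d v =>
        obtain rfl : d = a := by simpa using hv
        obtain ⟨k, k', R, h1, h2⟩ := las_same d v
        simp only [List.cons_append, List.nil_append, h1, h2, las_single, List.length_cons,
          List.length_nil]
        omega
    | cons b t =>
      rw [List.getLast?_cons_cons] at hu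
      have ih := ih hu
      simp only [List.cons_append] at ih ⊢
      by_cases h : a = b
      · subst h
        obtain ⟨k, k', R, h1, h2⟩ := las_same a t
        obtain ⟨l, l', S, h3, h4⟩ := las_same a (t ++ v)
        rw [h1, h3] at ih
        rw [h2, h4]
        simpa using ih
      · rw [las_one a b _ h, las_one a b _ h]
        simp only [List.length_cons]
        omega

theorem no_split (c : ℕ+) (n : ℕ) (u v : List ℕ+) (hu : u.getLast? = some c)
    (hv : (lookAndSay^[n] v).head? = some c)
    (h : ∀ n : ℕ, lookAndSay^[n] (u ++ v) = lookAndSay^[n] u ++ lookAndSay^[n] v) : False := by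
  have h1 := las_merge c (lookAndSay^[n] u) (lookAndSay^[n] v) (by rw [las_iter_last, hu]) hv
  have h2 := h (n+1)
  simp only [Function.iterate_succ_apply'] at h2
  rw [h n] at h2
  rw [h2, List.length_append] at h1
  omega

theorem head_six (t : List ℕ+) (ht : t = [] ∨ ∃ s, t = 3 :: s) :
    (lookAndSay^[6] (2 :: 3 :: 3 :: 2 :: t)).head? = some 3 := by
  obtain ⟨r, hr⟩ : ∃ r, lookAndSay (2 :: t) = 1 :: r := by
    rcases ht with rfl | ⟨s, rfl⟩
    · exact ⟨_, las_single 2⟩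
    · exact ⟨_, las_one 2 3 s (by decide)⟩
  simp only [Function.iterate_succ_apply, Function.iterate_zero_apply]
  rw [las_one 2 3 _ (by decide), las_two 3 2 _ (by decide), hr]
  rw [las_one 1 2 _ (by decide), las_two 2 3 _ (by decide), las_one 3 1 _ (by decide)]
  rw [las_two 1 2 _ (by decide), las_two 2 1 _ (by decide), las_one 1 3 _ (by decide)]
  rw [las_one 2 1 (2 :: 2 :: 1 :: _) (by decide), las_one 1 2 (2 :: 1 :: _) (by decide),
    las_two 2 1 _ (by decide)]
  rw [las_one 1 2 _ (by decide), las_one 2 1 _ (by decide), las_two 1 2 _ (by decide)]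
  rw [las_three 1 2 _ (by decide)]
  rfl

theorem cuts (n : ℕ) (u v : List ℕ+) (hu : u ≠ []) (hv : v ≠ [])
    (h : (List.replicate n ([3, 3, 2] : List ℕ+)).flatten = u ++ v) :
    (u.getLast? = some 3 ∧ v.head? = some 3) ∨
    (u.getLast? = some 2 ∧ ∃ t, v = 3 :: 3 :: 2 :: t) ∨
    (u.getLast? = some 3 ∧ (v = [2] ∨ ∃ t, v = 2 :: 3 :: 3 :: 2 :: t ∧
      (t = [] ∨ ∃ s, t = 3 :: s))) := by
  induction n generalizing u with
  | zero => simp at h; exact absurd h.1 hu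
  | succ n ih =>
    rw [List.replicate_succ, List.flatten_cons] at h
    match u, hu with
    | [a], _ =>
      simp at h
      obtain ⟨rfl, rfl⟩ := h
      left; simp
    | [a, b], _ =>
      simp at h
      obtain ⟨rfl, rfl, rfl⟩ := h
      right; right
      refine ⟨rfl, ?_⟩
      rcases n with _ | _ | n
      · left; rfl
      · right; exact ⟨[], rfl, Or.inl rfl⟩
      · right; exact ⟨_, rfl, Or.inr ⟨_, rfl⟩⟩
    | [a, b, c], _ =>
      simp at h
      obtain ⟨rfl, rfl, rfl, rfl⟩ := h
      right; left
      refine ⟨rfl, ?_⟩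
      rcases n with _ | n
      · simp at hv
      · exact ⟨_, rfl⟩
    | a :: b :: c :: d :: u, _ =>
      simp only [List.cons_append, List.nil_append, List.cons.injEq] at h
      have := ih (d :: u) (by simp) (by simpa using h.2.2.2)
      simpa only [List.getLast?_cons_cons] using this

/-- For every `n ≥ 1`, the `n`-fold concatenation of `(3,3,2)` is an atom. -/
theorem replicate_332_isAtom (n : ℕ) (hn : 1 ≤ n) :
    IsAtomWord (List.replicate n ([3, 3, 2] : List ℕ+)).flatten := by
  refine ⟨?_, ?_⟩
  · obtain ⟨m, rfl⟩ : ∃ m, n = m + 1 := ⟨n - 1, by omega⟩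
    simp [List.replicate_succ]
  · rintro ⟨u, v, hu, hv, hx, h⟩
    have hc := cuts n u v hu hv hx
    rw [hx] at h
    rcases hc with ⟨h1, h2⟩ | ⟨h1, t, rfl⟩ | ⟨h1, rfl | ⟨t, rfl, ht⟩⟩
    · exact no_split 3 0 u v h1 h2 h
    · refine no_split 2 1 u _ h1 ?_ h
      rw [Function.iterate_one, las_two 3 2 _ (by decide)]; rfl
    · refine no_split 3 3 u _ h1 ?_ h
      decide
    · exact no_split 3 6 u _ h1 (head_six t ht) h
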